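/- Policy iteration as Newton's method identity: For consecutive policy iteration iterates with π^{t+1} greedy w.r.t. V^{π^t}, the value functions satisfy V^{π^{t+1}} = V^{π^t} − (I − γP^{π^{t+1}})^{−1}(V^{π^t} − T V^{π^t}), where T is the Bellman optimality operator and P^{π^{t+1}} the transition matrix of π^{t+1}. -/

import Mathlib

open Finset Matrix

/-- The probability simplex over a finite action set. -/
def simplex (A : Type*) [Fintype A] : Set (A → ℝ) :=
  {p | (∀ a, 0 ≤ p a) ∧ ∑ a, p a = 1}

/-- For a row-stochastic matrix `M` and a discount factor `γ ∈ [0, 1)`, the matrix `1 - γ • M`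
is strictly diagonally dominant, hence invertible. -/
theorem det_one_sub_smul_ne_zero_of_row_stochastic {S : Type*} [Fintype S] [DecidableEq S]
    {γ : ℝ} (hγ0 : 0 ≤ γ) (hγ1 : γ < 1) {M : Matrix S S ℝ}
    (hM0 : ∀ i j, 0 ≤ M i j) (hM1 : ∀ i, ∑ j, M i j = 1) :
    ((1 : Matrix S S ℝ) - γ • M).det ≠ 0 := by
  refine det_ne_zero_of_sum_row_lt_diag fun k => ?_
  have hoff : ∑ j ∈ univ.erase k, ‖((1 : Matrix S S ℝ) - γ • M) k j‖
      = γ * ∑ j ∈ univ.erase k, M k j := by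
    rw [mul_sum]
    refine sum_congr rfl fun j hj => ?_
    rw [Matrix.sub_apply, Matrix.smul_apply, Matrix.one_apply_ne (ne_of_mem_erase hj).symm,
      zero_sub, norm_neg, smul_eq_mul, Real.norm_of_nonneg (mul_nonneg hγ0 (hM0 k j))]
  have hsum : M k k + ∑ j ∈ univ.erase k, M k j = 1 := by
    rw [add_sum_erase _ _ (mem_univ k), hM1]
  rw [hoff, Matrix.sub_apply, Matrix.smul_apply, Matrix.one_apply_eq, smul_eq_mul]
  refine lt_of_lt_of_le ?_ (Real.le_norm_self _)
  linear_combination hγ1 + γ * hsum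

/-- Averaging the one-step lookahead of `W` over a policy gives the expected reward plus the
discounted transition matrix of the policy applied to `W`. -/
theorem sum_policy_mul_lookahead {S A : Type*} [Fintype S] [Fintype A]
    (γ : ℝ) (r : S → A → ℝ) (P : S → A → S → ℝ) (π : S → A → ℝ) {M : Matrix S S ℝ}
    (hM : ∀ s s', M s s' = ∑ a, π s a * P s a s') (W : S → ℝ) (s : S) :
    ∑ a, π s a * (r s a + γ * ∑ s', P s a s' * W s')
      = ∑ a, π s a * r s a + γ * (M *ᵥ W) s := by
  simp only [mulVec, dotProduct, hM, mul_add, sum_add_distrib, mul_sum, sum_mul]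
  rw [sum_comm (s := (univ : Finset S))]
  congr 1
  exact sum_congr rfl fun a _ => sum_congr rfl fun s' _ => by ring

/-- **Policy iteration as Newton's method.** For consecutive policy-iteration
iterates, with `π^{t+1}` greedy w.r.t. `V^{π^t}` (i.e. attaining the Bellman
optimality operator `T` at `V^{π^t}`),
`V^{π^{t+1}} = V^{π^t} − (I − γP^{π^{t+1}})⁻¹ (V^{π^t} − T V^{π^t})`. -/
theorem policy_iteration_newton_identity
    {S A : Type*} [Fintype S] [DecidableEq S] [Fintype A] [Nonempty A]
    (γ : ℝ) (hγ0 : 0 < γ) (hγ1 : γ < 1)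
    (r : S → A → ℝ) (P : S → A → S → ℝ)
    (hP0 : ∀ s a s', 0 ≤ P s a s') (hP1 : ∀ s a, ∑ s', P s a s' = 1)
    -- current policy `π^t` with its value functions
    (π : S → A → ℝ) (hπ : ∀ s, π s ∈ simplex A)
    (Q : S → A → ℝ) (V : S → ℝ)
    (hV : ∀ s, V s = ∑ a, π s a * Q s a)
    (hQ : ∀ s a, Q s a = r s a + γ * ∑ s', P s a s' * V s')
    -- the Bellman optimality operator applied to `V^{π^t}`
    (TV : S → ℝ)
    (hTV : ∀ s, TV s =
      Finset.univ.sup' Finset.univ_nonempty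
        (fun a => r s a + γ * ∑ s', P s a s' * V s'))
    -- `π^{t+1}` greedy: it attains the maximum in `T V^{π^t}`
    (πnext : S → A → ℝ) (hπnext : ∀ s, πnext s ∈ simplex A)
    (hgreedy : ∀ s,
      (∑ a, πnext s a * (r s a + γ * ∑ s', P s a s' * V s')) = TV s)
    -- its value functions
    (Qnext : S → A → ℝ) (Vnext : S → ℝ)
    (hVnext : ∀ s, Vnext s = ∑ a, πnext s a * Qnext s a)
    (hQnext : ∀ s a, Qnext s a = r s a + γ * ∑ s', P s a s' * Vnext s')
    -- the transition matrix of `π^{t+1}`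
    (Pmat : Matrix S S ℝ)
    (hPmat : ∀ s s', Pmat s s' = ∑ a, πnext s a * P s a s') :
    Vnext = V - ((1 : Matrix S S ℝ) - γ • Pmat)⁻¹ *ᵥ (fun s => V s - TV s) := by
  have hPmat0 : ∀ s s', 0 ≤ Pmat s s' := fun s s' => by
    rw [hPmat]
    exact sum_nonneg fun a _ => mul_nonneg ((hπnext s).1 a) (hP0 s a s')
  have hPmat1 : ∀ s, ∑ s', Pmat s s' = 1 := fun s => by
    simp_rw [hPmat]
    rw [sum_comm]
    simp_rw [← mul_sum, hP1, mul_one]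
    exact (hπnext s).2
  have hdet : IsUnit ((1 : Matrix S S ℝ) - γ • Pmat).det :=
    (det_one_sub_smul_ne_zero_of_row_stochastic hγ0.le hγ1 hPmat0 hPmat1).isUnit
  have hresidual : (fun s => V s - TV s) = ((1 : Matrix S S ℝ) - γ • Pmat) *ᵥ (V - Vnext) := by
    funext s
    have hT := hgreedy s
    rw [sum_policy_mul_lookahead γ r P πnext hPmat] at hT
    have hN := hVnext s
    simp_rw [hQnext] at hN
    rw [sum_policy_mul_lookahead γ r P πnext hPmat] at hN
    simp only [sub_mulVec, one_mulVec, smul_mulVec, mulVec_sub, Pi.sub_apply, Pi.smul_apply,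
      smul_eq_mul]
    linear_combination hT + hN
  rw [hresidual, mulVec_mulVec, nonsing_inv_mul _ hdet, one_mulVec, sub_sub_cancel]
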